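/- Let k be a field of prime characteristic p > 2. Then Λ_k(p, 2p) has infinite global dimension: there exists a finitely generated Λ_k(p, 2p)-module which does not have finite projective dimension. -/

import Mathlib

universe u

/-- `PDimLE A n M`: the `A`-module `M` has projective dimension at most `n`,
witnessed by a projective resolution of length at most `n`. -/
def PDimLE (A : Type u) [Ring A] : ℕ → (M : Type u) → [AddCommGroup M] → [Module A M] → Prop
  | 0, M, _, _ => Module.Projective A M
  | n + 1, M, _, _ =>
      ∃ (P : Type u) (_ : AddCommGroup P) (_ : Module A P) (f : P →ₗ[A] M),
        Module.Projective A P ∧ Function.Surjective f ∧ PDimLE A n (LinearMap.ker f)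

/-- The representation of the symmetric group `S_d` on the `d`-th tensor power of `V = k^n`
by place permutations; the tensor power `V^{⊗ d}` is realised as the free `k`-module on the
set of multi-indices `Fin d → Fin n`, i.e. as the functions `(Fin d → Fin n) → k`. -/
def placePerm (k : Type u) [Field k] (n d : ℕ) :
    Representation k (Equiv.Perm (Fin d)) ((Fin d → Fin n) → k) where
  toFun σ :=
    { toFun := fun f v => f (v ∘ σ)
      map_add' := fun _ _ => rfl
      map_smul' := fun _ _ => rfl }
  map_one' := by ext f v; rfl
  map_mul' := fun σ τ => by ext f v; rfl

/-- The group algebra of the symmetric group on `d` letters over `k`. -/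
abbrev SymGroupAlgebra (k : Type u) [Field k] (d : ℕ) : Type u :=
  MonoidAlgebra k (Equiv.Perm (Fin d))

/-- The tensor space `V^{⊗ d}`, `V = k^n`, as a module over the group algebra of `S_d`
(the symmetric group acting by place permutations). -/
def TensorSpace (k : Type u) [Field k] (n d : ℕ) : Type u := (Fin d → Fin n) → k

instance (k : Type u) [Field k] (n d : ℕ) : AddCommGroup (TensorSpace k n d) :=
  inferInstanceAs (AddCommGroup ((Fin d → Fin n) → k))

instance (k : Type u) [Field k] (n d : ℕ) : Module k (TensorSpace k n d) :=
  inferInstanceAs (Module k ((Fin d → Fin n) → k))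

noncomputable instance (k : Type u) [Field k] (n d : ℕ) :
    Module (SymGroupAlgebra k d) (TensorSpace k n d) where
  smul r t := (placePerm k n d).asAlgebraHom r t
  one_smul t := by show (placePerm k n d).asAlgebraHom 1 t = t; rw [map_one]; rfl
  mul_smul r s t := by
    show (placePerm k n d).asAlgebraHom (r * s) t
      = (placePerm k n d).asAlgebraHom r ((placePerm k n d).asAlgebraHom s t)
    rw [map_mul]; rfl
  smul_zero r := map_zero ((placePerm k n d).asAlgebraHom r)
  smul_add r t₁ t₂ := map_add ((placePerm k n d).asAlgebraHom r) t₁ t₂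
  add_smul r s t := by
    show (placePerm k n d).asAlgebraHom (r + s) t
      = (placePerm k n d).asAlgebraHom r t + (placePerm k n d).asAlgebraHom s t
    rw [map_add]; rfl
  zero_smul t := by show (placePerm k n d).asAlgebraHom 0 t = 0; rw [map_zero]; rfl

lemma tensorSpace_smul_def (k : Type u) [Field k] {n d : ℕ} (r : SymGroupAlgebra k d)
    (t : TensorSpace k n d) : r • t = (placePerm k n d).asAlgebraHom r t := rfl

/-- The Schur algebra `S_k(n, d)`: the endomorphism algebra of the tensor space
`(k^n)^{⊗ d}` as a module over the group algebra of the symmetric group `S_d`.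
The tensor space is a left module over it by evaluation. -/
noncomputable abbrev SchurAlgebra (k : Type u) [Field k] (n d : ℕ) : Type u :=
  Module.End (SymGroupAlgebra k d) (TensorSpace k n d)

/-- The congruence relation on the group algebra `k S_d` corresponding to the two-sided
ideal `Ann_{k S_d}((k^n)^{⊗ d})`, the annihilator of the tensor space. -/
noncomputable def annihilatorCon (k : Type u) [Field k] (n d : ℕ) :
    RingCon (SymGroupAlgebra k d) where
  r a b := ∀ t : TensorSpace k n d, a • t = b • t
  iseqv :=
    ⟨fun _ _ => rfl, fun h t => (h t).symm, fun h₁ h₂ t => (h₁ t).trans (h₂ t)⟩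
  mul' := fun {a b c d'} h₁ h₂ t => by
    show (a * c) • t = (b * d') • t
    rw [mul_smul, mul_smul, h₂ t, h₁ (d' • t)]
  add' := fun {a b c d'} h₁ h₂ t => by
    show (a + c) • t = (b + d') • t
    rw [add_smul, add_smul, h₁ t, h₂ t]

/-- The algebra `Λ_k(n, d)`: the quotient of the group algebra of the symmetric group `S_d`
by the annihilator of the tensor space `(k^n)^{⊗ d}`. -/
noncomputable def LambdaAlgebra (k : Type u) [Field k] (n d : ℕ) : Type u :=
  (annihilatorCon k n d).Quotient

noncomputable instance (k : Type u) [Field k] (n d : ℕ) : Ring (LambdaAlgebra k n d) :=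
  inferInstanceAs (Ring (annihilatorCon k n d).Quotient)

/-- The tensor space is a module over `Λ_k(n, d)`. -/
noncomputable instance (k : Type u) [Field k] (n d : ℕ) :
    Module (LambdaAlgebra k n d) (TensorSpace k n d) where
  smul a t := Quotient.liftOn a (fun r => r • t) (fun _ _ h => h t)
  one_smul t := one_smul (SymGroupAlgebra k d) t
  mul_smul a b t := Quotient.inductionOn₂ a b (fun r s => mul_smul r s t)
  smul_zero a := Quotient.inductionOn a (fun r => smul_zero r)
  smul_add a t₁ t₂ := Quotient.inductionOn a (fun r => smul_add r t₁ t₂)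
  add_smul a b t := Quotient.inductionOn₂ a b (fun r s => add_smul r s t)
  zero_smul t := zero_smul (SymGroupAlgebra k d) t

/-- `Λ_k(n, d)` is a `k`-algebra. -/
noncomputable instance (k : Type u) [Field k] (n d : ℕ) : Algebra k (LambdaAlgebra k n d) :=
  RingHom.toAlgebra'
    ((RingCon.mk' (annihilatorCon k n d)).comp (algebraMap k (SymGroupAlgebra k d)))
    (fun c x => by
      refine Quotient.inductionOn x (fun r => ?_)
      show ((algebraMap k (SymGroupAlgebra k d) c * r : SymGroupAlgebra k d) :
          (annihilatorCon k n d).Quotient)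
        = ((r * algebraMap k (SymGroupAlgebra k d) c : SymGroupAlgebra k d) :
          (annihilatorCon k n d).Quotient)
      exact congrArg _ (Algebra.commutes c r))


section GenericTrace

open CategoryTheory

/-- projective dimension at most `n`, in terms of the Mathlib notion -/
def PD (A : Type u) [Ring A] (n : ℕ) (M : Type u) [AddCommGroup M] [Module A M] : Prop :=
  HasProjectiveDimensionLE (ModuleCat.of A M) n

section
variable {A : Type u} [Ring A]
  {M₁ M₂ M₃ : Type u} [AddCommGroup M₁] [Module A M₁] [AddCommGroup M₂] [Module A M₂]
  [AddCommGroup M₃] [Module A M₃]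

/-- the short complex of an exact pair -/
noncomputable abbrev mkSC (i : M₁ →ₗ[A] M₂) (q : M₂ →ₗ[A] M₃)
    (h : Function.Exact i q) : ShortComplex (ModuleCat.{u} A) :=
  ShortComplex.mk (ModuleCat.ofHom i) (ModuleCat.ofHom q) (by
    ext x; exact h.apply_apply_eq_zero x)

lemma mkSC_se (i : M₁ →ₗ[A] M₂) (q : M₂ →ₗ[A] M₃) (hi : Function.Injective i)
    (h : Function.Exact i q) (hq : Function.Surjective q) : (mkSC i q h).ShortExact where
  exact := (ShortComplex.ShortExact.moduleCat_exact_iff_function_exact _).mpr h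
  mono_f := (ModuleCat.mono_iff_injective _).mpr hi
  epi_g := (ModuleCat.epi_iff_surjective _).mpr hq

lemma PD_mid {n : ℕ} (i : M₁ →ₗ[A] M₂) (q : M₂ →ₗ[A] M₃) (hi : Function.Injective i)
    (h : Function.Exact i q) (hq : Function.Surjective q) (h1 : PD A n M₁) (h3 : PD A n M₃) :
    PD A n M₂ :=
  (mkSC_se i q hi h hq).hasProjectiveDimensionLT_X₂ (n + 1) h1 h3

lemma PD_of_proj (n : ℕ) [Module.Projective A M₁] : PD A n M₁ := by
  have : Projective (ModuleCat.of A M₁) := (IsProjective.iff_projective _).mp inferInstance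
  have h : HasProjectiveDimensionLT (ModuleCat.of A M₁) 1 := inferInstance
  exact hasProjectiveDimensionLT_of_ge _ 1 _ (by omega)

lemma PD_zero (h : PD A 0 M₁) : Module.Projective A M₁ := by
  have h' : HasProjectiveDimensionLT (ModuleCat.of A M₁) 1 := h
  have : Projective (ModuleCat.of A M₁) := inferInstance
  exact (IsProjective.iff_projective _).mpr this

lemma PD_mono {n m : ℕ} (hnm : n ≤ m) (h : PD A n M₁) : PD A m M₁ := by
  have h' : HasProjectiveDimensionLT (ModuleCat.of A M₁) (n + 1) := h
  exact hasProjectiveDimensionLT_of_ge _ (n + 1) _ (by omega)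

lemma exact_ker (f : M₂ →ₗ[A] M₃) : Function.Exact (LinearMap.ker f).subtype f := by
  intro x; simp

lemma PD_ker {n : ℕ} [Module.Projective A M₂] (f : M₂ →ₗ[A] M₃) (hf : Function.Surjective f)
    (h : PD A (n + 1) M₃) : PD A n (LinearMap.ker f) :=
  (mkSC_se (LinearMap.ker f).subtype f (Submodule.subtype_injective _)
    (exact_ker f) hf).hasProjectiveDimensionLT_X₁ (n + 1) (PD_of_proj n) h

lemma PD_coker {n : ℕ} [Module.Projective A M₂] (f : M₂ →ₗ[A] M₃) (hf : Function.Surjective f)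
    (h : PD A n (LinearMap.ker f)) : PD A (n + 1) M₃ :=
  (mkSC_se (LinearMap.ker f).subtype f (Submodule.subtype_injective _)
    (exact_ker f) hf).hasProjectiveDimensionLT_X₃ (n + 1) h (PD_of_proj (n + 1))

end

lemma PD_of_PDimLE {A : Type u} [Ring A] (n : ℕ) : ∀ (M : Type u) [AddCommGroup M] [Module A M],
    PDimLE A n M → PD A n M := by
  induction n with
  | zero =>
    intro M _ _ h
    have : Module.Projective A M := h
    exact PD_of_proj 0
  | succ n ih =>
    rintro M _ _ ⟨P, _, _, f, hP, hf, hk⟩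
    exact PD_coker f hf (ih _ hk)

variable {A : Type u} [Ring A] {k : Type u} [AddCommGroup k]

/-- finite dual basis -/
def IsDB {M : Type u} [AddCommGroup M] [Module A M] {ι : Type} [Fintype ι]
    (e : ι → M) (l : ι → M →ₗ[A] A) : Prop := ∀ x, ∑ j, l j x • e j = x

lemma db_exists (M : Type u) [AddCommGroup M] [Module A M] [Module.Finite A M]
    [Module.Projective A M] : ∃ (m : ℕ) (e : Fin m → M) (l : Fin m → M →ₗ[A] A), IsDB e l := by
  obtain ⟨m, f, hf⟩ := Module.Finite.exists_fin' A M
  obtain ⟨s, hs⟩ := Module.projective_lifting_property f LinearMap.id hf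
  refine ⟨m, fun j => f (Pi.single j 1), fun j => (LinearMap.proj j).comp s, fun x => ?_⟩
  have h1 := LinearMap.congr_fun hs x
  simp only [LinearMap.comp_apply, LinearMap.id_apply] at h1
  conv_rhs => rw [← h1]
  simp only [LinearMap.comp_apply, LinearMap.proj_apply, ← map_smul, ← map_sum]
  congr 1
  ext j
  simp [Finset.sum_apply, Pi.single_apply]

lemma db_tr_eq (τ : A →+ k) (hτ : ∀ a b, τ (a * b) = τ (b * a))
    {M : Type u} [AddCommGroup M] [Module A M] {ι κ : Type} [Fintype ι] [Fintype κ]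
    {e : ι → M} {l : ι → M →ₗ[A] A} (h : IsDB e l) {e' : κ → M} {l' : κ → M →ₗ[A] A}
    (h' : IsDB e' l') (φ : M →ₗ[A] M) :
    ∑ j, τ (l j (φ (e j))) = ∑ j, τ (l' j (φ (e' j))) := by
  have h1 : ∀ j, τ (l j (φ (e j))) = ∑ i, τ (l j (e' i) * l' i (φ (e j))) := by
    intro j
    conv_lhs => rw [← h' (φ (e j))]
    rw [map_sum, map_sum]
    refine Finset.sum_congr rfl fun i _ => ?_
    rw [map_smul, smul_eq_mul, hτ]
  have h2 : ∀ i, τ (l' i (φ (e' i))) = ∑ j, τ (l j (e' i) * l' i (φ (e j))) := by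
    intro i
    conv_lhs => rw [← h (e' i)]
    rw [map_sum, map_sum, map_sum]
    refine Finset.sum_congr rfl fun j _ => ?_
    rw [map_smul, map_smul, smul_eq_mul]
  rw [Finset.sum_congr rfl fun j _ => h1 j, Finset.sum_congr rfl fun i _ => h2 i,
    Finset.sum_comm]

open Classical in
/-- trace on finitely generated projectives -/
noncomputable def T0 (τ : A →+ k) (M : Type u) [AddCommGroup M] [Module A M] (φ : M →ₗ[A] M) : k :=
  if h : ∃ (m : ℕ) (e : Fin m → M) (l : Fin m → M →ₗ[A] A), IsDB e l then
    ∑ j, τ (h.choose_spec.choose_spec.choose j (φ (h.choose_spec.choose j))) else 0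

lemma T0_eq (τ : A →+ k) (hτ : ∀ a b, τ (a * b) = τ (b * a))
    {M : Type u} [AddCommGroup M] [Module A M] [Module.Finite A M]
    [Module.Projective A M] {ι : Type} [Fintype ι]
    {e : ι → M} {l : ι → M →ₗ[A] A} (h : IsDB e l) (φ : M →ₗ[A] M) :
    T0 τ M φ = ∑ j, τ (l j (φ (e j))) := by
  have hh := db_exists (A := A) M
  rw [T0, dif_pos hh]
  exact db_tr_eq τ hτ hh.choose_spec.choose_spec.choose_spec h φ

lemma T0_add (τ : A →+ k) (hτ : ∀ a b, τ (a * b) = τ (b * a))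
    {M₁ M₂ M₃ : Type u} [AddCommGroup M₁] [Module A M₁] [AddCommGroup M₂] [Module A M₂]
    [AddCommGroup M₃] [Module A M₃] [Module.Finite A M₁] [Module.Finite A M₂] [Module.Finite A M₃]
    [Module.Projective A M₁] [Module.Projective A M₂] [Module.Projective A M₃]
    (i : M₁ →ₗ[A] M₂) (q : M₂ →ₗ[A] M₃) (hi : Function.Injective i)
    (h : Function.Exact i q) (hq : Function.Surjective q)
    (φ₁ : M₁ →ₗ[A] M₁) (φ₂ : M₂ →ₗ[A] M₂) (φ₃ : M₃ →ₗ[A] M₃)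
    (h12 : ∀ x, i (φ₁ x) = φ₂ (i x)) (h23 : ∀ x, q (φ₂ x) = φ₃ (q x)) :
    T0 τ M₂ φ₂ = T0 τ M₁ φ₁ + T0 τ M₃ φ₃ := by
  obtain ⟨s, hs⟩ := Module.projective_lifting_property q LinearMap.id hq
  have hs' : ∀ x, q (s x) = x := fun x => LinearMap.congr_fun hs x
  have hr : ∀ x : M₂, ∃ y, i y = x - s (q x) := fun x => (h _).mp (by simp [hs'])
  choose r hr using hr
  let R : M₂ →ₗ[A] M₁ :=
    { toFun := r
      map_add' := fun x y => hi (by simp only [map_add, hr]; abel)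
      map_smul' := fun a x => hi (by simp only [map_smul, hr, smul_sub, RingHom.id_apply]) }
  have hR : ∀ x, i (R x) = x - s (q x) := hr
  have hRi : ∀ x, R (i x) = x := fun x => hi (by
    rw [hR, h.apply_apply_eq_zero]; simp)
  obtain ⟨m, e, l, hd⟩ := db_exists (A := A) M₁
  obtain ⟨m', e', l', hd'⟩ := db_exists (A := A) M₃
  have hD : IsDB (Sum.elim (fun j => i (e j)) (fun j => s (e' j)))
      (Sum.elim (fun j => (l j).comp R) (fun j => (l' j).comp q)) := by
    intro x
    simp only [Fintype.sum_sum_type, Sum.elim_inl, Sum.elim_inr, LinearMap.comp_apply,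
      ← map_smul, ← map_sum]
    rw [hd, hd', hR]; abel
  rw [T0_eq τ hτ hD, T0_eq τ hτ hd, T0_eq τ hτ hd']
  simp only [Fintype.sum_sum_type, Sum.elim_inl, Sum.elim_inr, LinearMap.comp_apply,
    ← h12, h23, hRi, hs']

lemma T0_zero (τ : A →+ k) (M : Type u) [AddCommGroup M] [Module A M] :
    T0 τ M (0 : M →ₗ[A] M) = 0 := by
  rw [T0]; split_ifs <;> simp

/-- the restriction to a kernel of a lift -/
noncomputable def kerMap {P M : Type u} [AddCommGroup P] [Module A P] [AddCommGroup M] [Module A M]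
    (f : P →ₗ[A] M) (φ : M →ₗ[A] M) (ψ : P →ₗ[A] P) (h : ∀ x, f (ψ x) = φ (f x)) :
    LinearMap.ker f →ₗ[A] LinearMap.ker f :=
  ψ.restrict (fun x hx => by
    rw [LinearMap.mem_ker] at *; rw [h, hx, map_zero])

@[simp] lemma kerMap_coe {P M : Type u} [AddCommGroup P] [Module A P] [AddCommGroup M] [Module A M]
    (f : P →ₗ[A] M) (φ : M →ₗ[A] M) (ψ : P →ₗ[A] P) (h : ∀ x, f (ψ x) = φ (f x))
    (x : LinearMap.ker f) : (kerMap f φ ψ h x : P) = ψ x := rfl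

/-- a free cover with lift of the endomorphism -/
structure Cov (M : Type u) [AddCommGroup M] [Module A M] (φ : M →ₗ[A] M) where
  m : ℕ
  f : (Fin m → A) →ₗ[A] M
  ψ : (Fin m → A) →ₗ[A] (Fin m → A)
  surj : Function.Surjective f
  comm : ∀ x, f (ψ x) = φ (f x)

lemma cov_exists (M : Type u) [AddCommGroup M] [Module A M] [Module.Finite A M] (φ : M →ₗ[A] M) :
    Nonempty (Cov M φ) := by
  obtain ⟨m, f, hf⟩ := Module.Finite.exists_fin' A M
  obtain ⟨s, hs⟩ := Module.projective_lifting_property f (φ.comp f) hf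
  exact ⟨⟨m, f, s, hf, fun x => LinearMap.congr_fun hs x⟩⟩

open Classical in
/-- the trace on modules of projective dimension at most `n` -/
noncomputable def TT (τ : A →+ k) : ℕ → (M : Type u) → [AddCommGroup M] → [Module A M] →
    (M →ₗ[A] M) → k
  | 0, M, _, _, φ => T0 τ M φ
  | n + 1, M, _, _, φ =>
    if h : Nonempty (Cov M φ) then
      T0 τ (Fin h.some.m → A) h.some.ψ -
        TT τ n (LinearMap.ker h.some.f) (kerMap h.some.f φ h.some.ψ h.some.comm)
    else 0

/-- additivity -/
def Additive' (τ : A →+ k) (n : ℕ) : Prop :=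
  ∀ (M₁ M₂ M₃ : Type u) [AddCommGroup M₁] [Module A M₁] [AddCommGroup M₂] [Module A M₂]
    [AddCommGroup M₃] [Module A M₃] [Module.Finite A M₁] [Module.Finite A M₂] [Module.Finite A M₃]
    (i : M₁ →ₗ[A] M₂) (q : M₂ →ₗ[A] M₃) (_ : Function.Injective i)
    (_ : Function.Exact i q) (_ : Function.Surjective q)
    (φ₁ : M₁ →ₗ[A] M₁) (φ₂ : M₂ →ₗ[A] M₂) (φ₃ : M₃ →ₗ[A] M₃)
    (_ : ∀ x, i (φ₁ x) = φ₂ (i x)) (_ : ∀ x, q (φ₂ x) = φ₃ (q x)),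
    PD A n M₁ → PD A n M₂ → PD A n M₃ →
    TT τ n M₂ φ₂ = TT τ n M₁ φ₁ + TT τ n M₃ φ₃

/-- agreement with `T0` -/
def Base' (τ : A →+ k) (n : ℕ) : Prop :=
  ∀ (P : Type u) [AddCommGroup P] [Module A P] [Module.Finite A P] [Module.Projective A P]
    (φ : P →ₗ[A] P), TT τ n P φ = T0 τ P φ

variable [IsNoetherianRing A]

lemma TT_indep (τ : A →+ k) (n : ℕ) (hA : Additive' (A := A) τ n) (hB : Base' (A := A) τ n)
    (M P Q : Type u) [AddCommGroup M] [Module A M] [Module.Finite A M]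
    [AddCommGroup P] [Module A P] [Module.Finite A P] [Module.Projective A P]
    [AddCommGroup Q] [Module A Q] [Module.Finite A Q] [Module.Projective A Q]
    (hM : PD A (n + 1) M) (φ : M →ₗ[A] M)
    (f : P →ₗ[A] M) (ψ : P →ₗ[A] P) (hf : Function.Surjective f) (hc : ∀ x, f (ψ x) = φ (f x))
    (g : Q →ₗ[A] M) (θ : Q →ₗ[A] Q) (hg : Function.Surjective g) (hd : ∀ x, g (θ x) = φ (g x)) :
    T0 τ P ψ - TT τ n (LinearMap.ker f) (kerMap f φ ψ hc) =
    T0 τ Q θ - TT τ n (LinearMap.ker g) (kerMap g φ θ hd) := by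
  let D : P × Q →ₗ[A] M := f.comp (LinearMap.fst A P Q) - g.comp (LinearMap.snd A P Q)
  have hD : ∀ x, D x = f x.1 - g x.2 := fun x => rfl
  have hmem : ∀ x : LinearMap.ker D, f x.1.1 = g x.1.2 := fun x => by
    have := x.2
    rw [LinearMap.mem_ker, hD, sub_eq_zero] at this
    exact this
  let ρ : LinearMap.ker D →ₗ[A] LinearMap.ker D := kerMap D φ (ψ.prodMap θ) (fun x => by
    simp [hD, hc, hd])
  let i₁ : LinearMap.ker g →ₗ[A] LinearMap.ker D :=
    LinearMap.codRestrict _ ((LinearMap.inr A P Q).comp (LinearMap.ker g).subtype) (fun x => by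
      have := x.2
      rw [LinearMap.mem_ker] at this
      simp [hD])
  let q₁ : LinearMap.ker D →ₗ[A] P := (LinearMap.fst A P Q).comp (LinearMap.ker D).subtype
  let i₂ : LinearMap.ker f →ₗ[A] LinearMap.ker D :=
    LinearMap.codRestrict _ ((LinearMap.inl A P Q).comp (LinearMap.ker f).subtype) (fun x => by
      have := x.2
      rw [LinearMap.mem_ker] at this
      simp [hD])
  let q₂ : LinearMap.ker D →ₗ[A] Q := (LinearMap.snd A P Q).comp (LinearMap.ker D).subtype
  have hi₁ : Function.Injective i₁ := fun x y h => by
    have := congrArg (fun z : LinearMap.ker D => z.1.2) h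
    exact Subtype.ext this
  have hi₂ : Function.Injective i₂ := fun x y h => by
    have := congrArg (fun z : LinearMap.ker D => z.1.1) h
    exact Subtype.ext this
  have hq₁ : Function.Surjective q₁ := fun x => by
    obtain ⟨y, hy⟩ := hg (f x)
    exact ⟨⟨(x, y), by rw [LinearMap.mem_ker, hD]; simp [hy]⟩, rfl⟩
  have hq₂ : Function.Surjective q₂ := fun y => by
    obtain ⟨x, hx⟩ := hf (g y)
    exact ⟨⟨(x, y), by rw [LinearMap.mem_ker, hD]; simp [hx]⟩, rfl⟩
  have he₁ : Function.Exact i₁ q₁ := by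
    intro z
    constructor
    · intro hz
      have hz' : z.1.1 = 0 := hz
      refine ⟨⟨z.1.2, ?_⟩, ?_⟩
      · rw [LinearMap.mem_ker, ← hmem z, hz', map_zero]
      · exact Subtype.ext (Prod.ext hz'.symm rfl)
    · rintro ⟨y, rfl⟩; rfl
  have he₂ : Function.Exact i₂ q₂ := by
    intro z
    constructor
    · intro hz
      have hz' : z.1.2 = 0 := hz
      refine ⟨⟨z.1.1, ?_⟩, ?_⟩
      · rw [LinearMap.mem_ker, hmem z, hz', map_zero]
      · exact Subtype.ext (Prod.ext rfl hz'.symm)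
    · rintro ⟨y, rfl⟩; rfl
  have hR : PD A n (LinearMap.ker D) :=
    PD_mid i₁ q₁ hi₁ he₁ hq₁ (PD_ker g hg hM) (PD_of_proj n)
  have e₁ := hA _ _ _ i₁ q₁ hi₁ he₁ hq₁ (kerMap g φ θ hd) ρ ψ
    (fun x => Subtype.ext (Prod.ext (map_zero ψ).symm rfl)) (fun x => rfl)
    (PD_ker g hg hM) hR (PD_of_proj n)
  have e₂ := hA _ _ _ i₂ q₂ hi₂ he₂ hq₂ (kerMap f φ ψ hc) ρ θ
    (fun x => Subtype.ext (Prod.ext rfl (map_zero θ).symm)) (fun x => rfl)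
    (PD_ker f hf hM) hR (PD_of_proj n)
  rw [hB P] at e₁
  rw [hB Q] at e₂
  rw [e₁] at e₂
  rw [sub_eq_sub_iff_add_eq_add, add_comm, e₂, add_comm]

lemma TT_succ (τ : A →+ k) (n : ℕ) (hA : Additive' (A := A) τ n) (hB : Base' (A := A) τ n)
    (M P : Type u) [AddCommGroup M] [Module A M] [Module.Finite A M]
    [AddCommGroup P] [Module A P] [Module.Finite A P] [Module.Projective A P]
    (hM : PD A (n + 1) M) (φ : M →ₗ[A] M)
    (f : P →ₗ[A] M) (ψ : P →ₗ[A] P) (hf : Function.Surjective f) (hc : ∀ x, f (ψ x) = φ (f x)) :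
    TT τ (n + 1) M φ = T0 τ P ψ - TT τ n (LinearMap.ker f) (kerMap f φ ψ hc) := by
  have h := cov_exists M φ
  rw [TT, dif_pos h]
  exact TT_indep τ n hA hB M _ P hM φ _ _ h.some.surj h.some.comm f ψ hf hc

lemma TT_add (τ : A →+ k) (hτ : ∀ a b, τ (a * b) = τ (b * a)) (n : ℕ) :
    Additive' (A := A) τ n ∧ Base' (A := A) τ n := by
  induction n with
  | zero =>
    refine ⟨?_, fun P _ _ _ _ φ => rfl⟩
    intro M₁ M₂ M₃ _ _ _ _ _ _ _ _ _ i q hi h hq φ₁ φ₂ φ₃ h12 h23 p1 p2 p3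
    have := PD_zero p1
    have := PD_zero p2
    have := PD_zero p3
    exact T0_add τ hτ i q hi h hq φ₁ φ₂ φ₃ h12 h23
  | succ n ih =>
    obtain ⟨hA, hB⟩ := ih
    constructor
    · intro M₁ M₂ M₃ _ _ _ _ _ _ _ _ _ i q hi h hq φ₁ φ₂ φ₃ h12 h23 p1 p2 p3
      obtain ⟨c₁⟩ := cov_exists M₁ φ₁
      obtain ⟨c₂⟩ := cov_exists M₂ φ₂
      let Q := Fin c₁.m → A
      let P := Fin c₂.m → A
      let g : P →ₗ[A] M₃ := q.comp c₂.f
      have hg : Function.Surjective g := hq.comp c₂.surj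
      have hgc : ∀ x, g (c₂.ψ x) = φ₃ (g x) := fun x => by
        simp [g, c₂.comm, h23]
      let F : Q × P →ₗ[A] M₂ := (i.comp c₁.f).coprod c₂.f
      have hFx : ∀ x, F x = i (c₁.f x.1) + c₂.f x.2 := fun x => rfl
      have hF : Function.Surjective F := fun y => by
        obtain ⟨x, hx⟩ := c₂.surj y
        exact ⟨(0, x), by simp [hFx, hx]⟩
      have hFc : ∀ x, F ((c₁.ψ.prodMap c₂.ψ) x) = φ₂ (F x) := fun x => by
        simp [hFx, c₁.comm, c₂.comm, h12]
      rw [TT_succ τ n hA hB M₁ Q p1 φ₁ c₁.f c₁.ψ c₁.surj c₁.comm,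
        TT_succ τ n hA hB M₃ P p3 φ₃ g c₂.ψ hg hgc,
        TT_succ τ n hA hB M₂ (Q × P) p2 φ₂ F _ hF hFc]
      have t0 : T0 τ (Q × P) (c₁.ψ.prodMap c₂.ψ) = T0 τ Q c₁.ψ + T0 τ P c₂.ψ :=
        T0_add τ hτ (LinearMap.inl A Q P) (LinearMap.snd A Q P) LinearMap.inl_injective
          Function.Exact.inl_snd LinearMap.snd_surjective _ _ _ (fun x => by simp) (fun x => rfl)
      let j : LinearMap.ker c₁.f →ₗ[A] LinearMap.ker F :=
        LinearMap.codRestrict _ ((LinearMap.inl A Q P).comp (LinearMap.ker c₁.f).subtype)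
          (fun x => by
            have := x.2
            rw [LinearMap.mem_ker] at this
            simp [hFx])
      have hmem : ∀ z : LinearMap.ker F, i (c₁.f z.1.1) + c₂.f z.1.2 = 0 := fun z => by
        have := z.2
        rwa [LinearMap.mem_ker, hFx] at this
      let r : LinearMap.ker F →ₗ[A] LinearMap.ker g :=
        LinearMap.codRestrict _ ((LinearMap.snd A Q P).comp (LinearMap.ker F).subtype)
          (fun z => by
            have := congrArg q (hmem z)
            rw [map_add, h.apply_apply_eq_zero, zero_add, map_zero] at this
            exact this)
      have hj : Function.Injective j := fun x y h => by
        have := congrArg (fun z : LinearMap.ker F => z.1.1) h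
        exact Subtype.ext this
      have hr : Function.Surjective r := fun y => by
        have hy : q (c₂.f y.1) = 0 := y.2
        obtain ⟨a, ha⟩ := (h _).mp hy
        obtain ⟨b, hb⟩ := c₁.surj a
        exact ⟨⟨(-b, y.1), by rw [LinearMap.mem_ker, hFx]; simp [hb, ha]⟩, rfl⟩
      have hjr : Function.Exact j r := by
        intro z
        constructor
        · intro hz
          have hz' : z.1.2 = 0 := congrArg Subtype.val hz
          refine ⟨⟨z.1.1, ?_⟩, ?_⟩
          · have := hmem z
            rw [hz', map_zero, add_zero] at this
            exact hi (by rw [this, map_zero])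
          · exact Subtype.ext (Prod.ext rfl hz'.symm)
        · rintro ⟨y, rfl⟩; rfl
      have e := hA _ _ _ j r hj hjr hr (kerMap c₁.f φ₁ c₁.ψ c₁.comm)
        (kerMap F φ₂ (c₁.ψ.prodMap c₂.ψ) hFc) (kerMap g φ₃ c₂.ψ hgc)
        (fun x => Subtype.ext (Prod.ext rfl (map_zero c₂.ψ).symm)) (fun x => rfl)
        (PD_ker _ c₁.surj p1) (PD_ker _ hF p2) (PD_ker _ hg p3)
      rw [e, t0]; abel
    · intro P _ _ _ _ φ
      rw [TT_succ τ n hA hB P P (PD_of_proj _) φ LinearMap.id φ Function.surjective_id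
        (fun x => rfl)]
      have hs : ∀ x : LinearMap.ker (LinearMap.id : P →ₗ[A] P), x = 0 := fun x =>
        Subtype.ext x.2
      have hpd : PD A n (LinearMap.ker (LinearMap.id : P →ₗ[A] P)) :=
        PD_ker LinearMap.id Function.surjective_id (PD_of_proj _)
      have e := hA _ _ _ (LinearMap.id : LinearMap.ker (LinearMap.id : P →ₗ[A] P) →ₗ[A] _)
        (LinearMap.id : LinearMap.ker (LinearMap.id : P →ₗ[A] P) →ₗ[A] _)
        Function.injective_id
        (fun x => ⟨fun _ => ⟨x, rfl⟩, fun _ => hs _⟩) Function.surjective_id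
        (kerMap LinearMap.id φ φ (fun x => rfl)) (kerMap LinearMap.id φ φ (fun x => rfl))
        (kerMap LinearMap.id φ φ (fun x => rfl)) (fun _ => rfl) (fun _ => rfl) hpd hpd hpd
      rw [left_eq_add.mp e, sub_zero]

lemma TT_zero (τ : A →+ k) (hτ : ∀ a b, τ (a * b) = τ (b * a)) (n : ℕ) :
    ∀ (M : Type u) [AddCommGroup M] [Module A M] [Module.Finite A M], PD A n M →
    TT τ n M (0 : M →ₗ[A] M) = 0 := by
  induction n with
  | zero => intro M _ _ _ _; exact T0_zero τ M
  | succ n ih =>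
    intro M _ _ _ hM
    obtain ⟨m, f, hf⟩ := Module.Finite.exists_fin' A M
    obtain ⟨hA, hB⟩ := TT_add (A := A) τ hτ n
    rw [TT_succ τ n hA hB M (Fin m → A) hM 0 f 0 hf (by simp), T0_zero]
    have : kerMap f 0 0 (by simp) = 0 := by ext x; rfl
    rw [this, ih _ (PD_ker f hf hM), sub_zero]

lemma TT_nilp (τ : A →+ k) (hτ : ∀ a b, τ (a * b) = τ (b * a))
    (hfin : ∀ (M : Type u) [AddCommGroup M] [Module A M] [Module.Finite A M], ∃ n, PD A n M)
    (N : ℕ) : ∀ (M : Type u) [AddCommGroup M] [Module A M] [Module.Finite A M] (φ : M →ₗ[A] M),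
    φ ^ N = 0 → ∃ n₀, ∀ n, n₀ ≤ n → TT τ n M φ = 0 := by
  induction N with
  | zero =>
    intro M _ _ _ φ h
    obtain ⟨n₀, h₀⟩ := hfin M
    refine ⟨n₀, fun n hn => ?_⟩
    have : φ = 0 := by rw [← mul_one φ, ← pow_zero φ, h, mul_zero]
    rw [this]
    exact TT_zero τ hτ n M (PD_mono hn h₀)
  | succ N ih =>
    intro M _ _ _ φ h
    let φ₃ : LinearMap.range φ →ₗ[A] LinearMap.range φ :=
      φ.restrict (fun x _ => ⟨x, rfl⟩)
    have h₃ : φ₃ ^ N = 0 := by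
      have key : ∀ (r : ℕ) (x : LinearMap.range φ), ((φ₃ ^ r) x : M) = (φ ^ r) x := by
        intro r
        induction r with
        | zero => intro x; rfl
        | succ r ihr =>
          intro x
          rw [pow_succ, pow_succ, Module.End.mul_apply, Module.End.mul_apply, ihr]
          rfl
      ext ⟨x, y, rfl⟩
      rw [key]
      have := LinearMap.congr_fun h y
      rw [pow_succ, Module.End.mul_apply] at this
      exact this
    obtain ⟨n₃, hn₃⟩ := ih _ φ₃ h₃
    obtain ⟨a, ha⟩ := hfin M
    obtain ⟨b, hb⟩ := hfin (LinearMap.ker φ)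
    obtain ⟨c, hc⟩ := hfin (LinearMap.range φ)
    refine ⟨n₃ + a + b + c, fun n hn => ?_⟩
    have e := (TT_add (A := A) τ hτ n).1 _ _ _ (LinearMap.ker φ).subtype φ.rangeRestrict
      (Submodule.subtype_injective _)
      (fun x => by
        simp only [Set.mem_range]
        constructor
        · intro hx
          exact ⟨⟨x, congrArg Subtype.val hx⟩, rfl⟩
        · rintro ⟨y, rfl⟩
          exact Subtype.ext y.2)
      φ.surjective_rangeRestrict 0 φ φ₃
      (fun x => by
        have := x.2
        rw [LinearMap.mem_ker] at this
        simp) (fun x => rfl) (PD_mono (by omega) hb) (PD_mono (by omega) ha)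
        (PD_mono (by omega) hc)
    rw [e, hn₃ n (by omega), TT_zero τ hτ n _ (PD_mono (by omega) hb), add_zero]

/-- Lenzing: in finite global dimension, traces vanish on nilpotents. -/
theorem lenzing (τ : A →+ k) (hτ : ∀ a b, τ (a * b) = τ (b * a))
    (hfin : ∀ (M : Type u) [AddCommGroup M] [Module A M] [Module.Finite A M], ∃ n, PD A n M)
    (x : A) (N : ℕ) (hx : x ^ N = 0) : τ x = 0 := by
  let φ : A →ₗ[A] A := LinearMap.toSpanSingleton A A x
  have hφ : ∀ (r : ℕ) (y : A), (φ ^ r) y = y * x ^ r := by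
    intro r
    induction r with
    | zero => intro y; simp
    | succ r ih =>
      intro y
      rw [pow_succ, Module.End.mul_apply, ih, pow_succ']
      simp [φ, mul_assoc]
  obtain ⟨n₀, h⟩ := TT_nilp τ hτ hfin N A φ (by ext; rw [hφ, hx]; simp)
  have h1 := h n₀ le_rfl
  rw [(TT_add (A := A) τ hτ n₀).2] at h1
  have hdb : IsDB (A := A) (M := A) (fun _ : Unit => 1) (fun _ => LinearMap.id) := fun y => by simp
  rw [T0_eq τ hτ hdb] at h1
  simpa [φ] using h1

end GenericTrace

section Specific

instance lambda_noeth (k : Type u) [Field k] (n d : ℕ) : IsNoetherianRing (LambdaAlgebra k n d) := by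
  have h1 : IsNoetherianRing (SymGroupAlgebra k d) := IsNoetherianRing.of_finite k _
  exact isNoetherianRing_of_surjective (SymGroupAlgebra k d) (LambdaAlgebra k n d)
    (RingCon.mk' (annihilatorCon k n d)) (RingCon.mk'_surjective _)

/-- the quotient map -/
noncomputable def lmk (k : Type u) [Field k] (n d : ℕ) : SymGroupAlgebra k d →+* LambdaAlgebra k n d :=
  RingCon.mk' (annihilatorCon k n d)

lemma lmk_surj (k : Type u) [Field k] (n d : ℕ) : Function.Surjective (lmk k n d) :=
  RingCon.mk'_surjective _

lemma lmk_smul (k : Type u) [Field k] (n d : ℕ) (r : SymGroupAlgebra k d) (t : TensorSpace k n d) :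
    lmk k n d r • t = (placePerm k n d).asAlgebraHom r t := rfl

/-- basis vector of tensor space -/
noncomputable def dlt (k : Type u) [Field k] (n d : ℕ) (v : Fin d → Fin n) : TensorSpace k n d :=
  (Pi.single v 1 : (Fin d → Fin n) → k)

/-- evaluation of a tensor at a multi-index -/
def evT (k : Type u) [Field k] (n d : ℕ) (v : Fin d → Fin n) : TensorSpace k n d →+ k where
  toFun t := t v
  map_zero' := rfl
  map_add' _ _ := rfl

/-- invariant multi-indices with first entry zero -/
def fixSet (n d : ℕ) [NeZero n] [NeZero d] (σ : Equiv.Perm (Fin d)) : Finset (Fin d → Fin n) :=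
  Finset.univ.filter (fun v => v 0 = 0 ∧ v ∘ σ = v)

/-- the trace function -/
noncomputable def tauF (k : Type u) [Field k] (n d : ℕ) [NeZero n] [NeZero d] :
    LambdaAlgebra k n d →+ k where
  toFun a := ∑ v ∈ Finset.univ.filter (fun v : Fin d → Fin n => v 0 = 0),
    evT k n d v (a • dlt k n d v)
  map_zero' := by simp
  map_add' a b := by simp only [add_smul, map_add, Finset.sum_add_distrib]

lemma tauF_single (k : Type u) [Field k] (n d : ℕ) [NeZero n] [NeZero d]
    (σ : Equiv.Perm (Fin d)) (c : k) :
    tauF k n d (lmk k n d (MonoidAlgebra.single σ c)) = c * ((fixSet n d σ).card : k) := by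
  show ∑ v ∈ Finset.univ.filter (fun v : Fin d → Fin n => v 0 = 0),
    evT k n d v (_ • dlt k n d v) = _
  have : ∀ v : Fin d → Fin n, evT k n d v (lmk k n d (MonoidAlgebra.single σ c) • dlt k n d v)
      = if v ∘ σ = v then c else 0 := by
    intro v
    rw [lmk_smul, Representation.asAlgebraHom_single]
    show c * (Pi.single v 1 : (Fin d → Fin n) → k) (v ∘ σ) = _
    rw [Pi.single_apply]
    split_ifs <;> simp
  simp only [this]
  rw [← Finset.sum_filter, Finset.filter_filter, Finset.sum_const, nsmul_eq_mul, mul_comm]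
  rfl

lemma fixSet_card (n d : ℕ) [NeZero n] [NeZero d] (σ τ : Equiv.Perm (Fin d)) :
    (fixSet n d (σ * τ)).card = (fixSet n d (τ * σ)).card := by
  have key : ∀ (σ τ : Equiv.Perm (Fin d)) (v : Fin d → Fin n), (∀ x, v (σ (τ x)) = v x) →
      (fun x => v (σ x) - v (σ 0)) ∈ fixSet n d (τ * σ) := by
    intro σ τ v h
    simp only [fixSet, Finset.mem_filter, Finset.mem_univ, true_and, sub_self]
    funext x
    simp [Function.comp, h]
  refine Finset.card_bij' (fun v _ x => v (σ x) - v (σ 0)) (fun v _ x => v (τ x) - v (τ 0))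
    ?_ ?_ ?_ ?_
  · intro v hv
    simp only [fixSet, Finset.mem_filter, Finset.mem_univ, true_and] at hv
    exact key σ τ v (fun x => congrFun hv.2 x)
  · intro v hv
    simp only [fixSet, Finset.mem_filter, Finset.mem_univ, true_and] at hv
    exact key τ σ v (fun x => congrFun hv.2 x)
  · intro v hv
    simp only [fixSet, Finset.mem_filter, Finset.mem_univ, true_and] at hv
    have h : ∀ x, v (σ (τ x)) = v x := fun x => congrFun hv.2 x
    funext x
    simp [h, hv.1]
  · intro v hv
    simp only [fixSet, Finset.mem_filter, Finset.mem_univ, true_and] at hv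
    have h : ∀ x, v (τ (σ x)) = v x := fun x => congrFun hv.2 x
    funext x
    simp [h, hv.1]

lemma tauF_comm (k : Type u) [Field k] (n d : ℕ) [NeZero n] [NeZero d] (a b : LambdaAlgebra k n d) :
    tauF k n d (a * b) = tauF k n d (b * a) := by
  obtain ⟨a, rfl⟩ := lmk_surj k n d a
  obtain ⟨b, rfl⟩ := lmk_surj k n d b
  rw [← map_mul, ← map_mul]
  induction a using MonoidAlgebra.induction_linear with
  | zero => simp
  | add f g hf hg => simp only [add_mul, mul_add, map_add, hf, hg]
  | single σ c =>
    induction b using MonoidAlgebra.induction_linear with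
    | zero => simp
    | add f g hf hg => simp only [add_mul, mul_add, map_add, hf, hg]
    | single τ e =>
      rw [MonoidAlgebra.single_mul_single, MonoidAlgebra.single_mul_single, tauF_single,
        tauF_single, fixSet_card, mul_comm c e]

lemma finRotate_pow_val (d : ℕ) [NeZero d] (m : ℕ) (x : Fin d) :
    ((finRotate d ^ m) x : ℕ) = (x + m) % d := by
  induction m with
  | zero => simp [Nat.mod_eq_of_lt x.2]
  | succ m ih =>
    rw [pow_succ', Equiv.Perm.mul_apply]
    obtain ⟨d, rfl⟩ := Nat.exists_eq_succ_of_ne_zero (NeZero.ne d)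
    rw [finRotate_apply, Fin.val_add, ih, Fin.val_one', ← Nat.add_mod, add_assoc]

lemma fixSet_rot (n d : ℕ) [NeZero n] [NeZero d] : (fixSet n d (finRotate d)).card = 1 := by
  rw [Finset.card_eq_one]
  refine ⟨0, ?_⟩
  ext v
  simp only [fixSet, Finset.mem_filter, Finset.mem_univ, true_and, Finset.mem_singleton]
  constructor
  · rintro ⟨h0, h⟩
    have : ∀ m : ℕ, v ((finRotate d ^ m) 0) = 0 := by
      intro m
      induction m with
      | zero => simpa using h0
      | succ m ih =>
        rw [pow_succ', Equiv.Perm.mul_apply]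
        exact (congrFun h _).trans ih
    funext x
    have hx := this x
    have : (finRotate d ^ (x : ℕ)) 0 = x := by
      apply Fin.ext
      rw [finRotate_pow_val]
      simp [Nat.mod_eq_of_lt x.2]
    rw [this] at hx
    exact hx
  · rintro rfl
    exact ⟨rfl, rfl⟩

lemma fixSet_rot_pow (p : ℕ) (hp : p.Prime) [NeZero p] [NeZero (2 * p)] :
    p ∣ (fixSet p (2 * p) (finRotate (2 * p) ^ p)).card := by
  have hp1 := hp.two_le
  let H : AddSubgroup (Fin (2 * p) → Fin p) :=
    { carrier := {v | v 0 = 0 ∧ v ∘ (finRotate (2 * p) ^ p : Equiv.Perm _) = v}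
      zero_mem' := ⟨rfl, rfl⟩
      add_mem' := by
        rintro a b ⟨ha, ha'⟩ ⟨hb, hb'⟩
        refine ⟨by simp [ha, hb], ?_⟩
        funext x
        have h1 := congrFun ha' x
        have h2 := congrFun hb' x
        simp only [Function.comp, Pi.add_apply] at *
        rw [h1, h2]
      neg_mem' := by
        rintro a ⟨ha, ha'⟩
        refine ⟨by simp [ha], ?_⟩
        funext x
        have h1 := congrFun ha' x
        simp only [Function.comp, Pi.neg_apply] at *
        rw [h1] }
  have hc : (fixSet p (2 * p) (finRotate (2 * p) ^ p)).card = Nat.card H := by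
    rw [← Nat.card_eq_finsetCard]
    refine Nat.card_congr (Equiv.subtypeEquivRight fun v => ?_)
    simp only [fixSet, Finset.mem_filter, Finset.mem_univ, true_and]
    rfl
  rw [hc]
  have hd : Nat.card H ∣ p ^ (2 * p) := by
    have := H.card_addSubgroup_dvd_card
    simpa using this
  obtain ⟨m, -, hm⟩ := (Nat.dvd_prime_pow hp).mp hd
  rw [hm]
  refine dvd_pow_self p ?_
  rintro rfl
  rw [pow_zero, Nat.card_eq_one_iff_unique] at hm
  obtain ⟨hs, -⟩ := hm
  have h01 : (1 : Fin p) ≠ 0 := by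
    intro h
    have := congrArg Fin.val h
    rw [Fin.val_one', Nat.mod_eq_of_lt (by omega)] at this
    simp at this
  let w : Fin (2 * p) → Fin p := fun x => if (x : ℕ) % p = 1 then 1 else 0
  have hw : w ∈ H := by
    constructor
    · simp [w]
    · funext x
      simp only [w, Function.comp, finRotate_pow_val]
      rw [Nat.mod_mod_of_dvd _ (Dvd.intro_left 2 rfl), Nat.add_mod_right]
  have := congrArg Subtype.val (hs.elim ⟨w, hw⟩ 0)
  have h2 := congrFun this ⟨1, by omega⟩
  simp only [w] at h2
  rw [if_pos (Nat.mod_eq_of_lt (by omega))] at h2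
  exact h01 h2

end Specific

/-- Let `k` be a field of prime characteristic `p > 2`. Then `Λ_k(p, 2p)` has infinite
global dimension: there is a finitely generated `Λ_k(p, 2p)`-module which does not have
finite projective dimension. -/
theorem lambdaAlgebra_infinite_globalDimension (k : Type u) [Field k] (p : ℕ)
    (hp : p.Prime) [CharP k p] (hp2 : 2 < p) :
    ∃ (M : Type u) (_ : AddCommGroup M) (_ : Module (LambdaAlgebra k p (2 * p)) M),
      Module.Finite (LambdaAlgebra k p (2 * p)) M ∧
      ∀ n : ℕ, ¬ PDimLE (LambdaAlgebra k p (2 * p)) n M := by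
  by_contra hcon
  push Not at hcon
  have : Fact p.Prime := ⟨hp⟩
  have : NeZero p := ⟨hp.ne_zero⟩
  have : NeZero (2 * p) := ⟨by have := hp.pos; omega⟩
  have hfin : ∀ (M : Type u) [AddCommGroup M] [Module (LambdaAlgebra k p (2 * p)) M]
      [Module.Finite (LambdaAlgebra k p (2 * p)) M], ∃ n, PD (LambdaAlgebra k p (2 * p)) n M := by
    intro M _ _ hM
    obtain ⟨n, hn⟩ := hcon M _ _ hM
    exact ⟨n, PD_of_PDimLE n M hn⟩
  let c : Equiv.Perm (Fin (2 * p)) := finRotate (2 * p)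
  have hc : c ^ (2 * p) = 1 := by
    ext x
    rw [finRotate_pow_val]
    simp [Nat.mod_eq_of_lt x.2]
  have hcp : c ^ (p * p) = c ^ p := by
    obtain ⟨m, hm⟩ := hp.odd_of_ne_two (by omega)
    have : p * p = 2 * p * m + p := by
      conv_lhs => rw [hm]
      conv_rhs => rw [hm]
      ring
    rw [this, pow_add, pow_mul, hc, one_pow, one_mul]
  let X : SymGroupAlgebra k (2 * p) := MonoidAlgebra.of k _ c
  let x : SymGroupAlgebra k (2 * p) := X - X ^ p
  have hch : CharP (SymGroupAlgebra k (2 * p)) p :=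
    charP_of_injective_algebraMap (algebraMap k (SymGroupAlgebra k (2 * p))).injective p
  have hx : x ^ p = 0 := by
    show (X - X ^ p) ^ p = 0
    rw [sub_pow_char_of_commute _ (Commute.self_pow X p), ← pow_mul]
    simp only [X, ← map_pow, hcp, sub_self]
  have h0 := lenzing (tauF k p (2 * p)) (tauF_comm k p (2 * p)) hfin (lmk k p (2 * p) x) p
    (by rw [← map_pow, hx, map_zero])
  have hX : X = MonoidAlgebra.single c 1 := rfl
  have hXp : X ^ p = MonoidAlgebra.single (c ^ p) 1 := by
    simp only [X, ← map_pow]; rfl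
  rw [map_sub, map_sub, hXp, hX, tauF_single, tauF_single, fixSet_rot,
    (CharP.cast_eq_zero_iff k p _).mpr (fixSet_rot_pow p hp)] at h0
  simp at h0
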